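/- arXiv:0903.2167 — 3 statements merged into one kernel-verified Lean document; each statement's English description precedes it below -/
import Mathlib

section
/- There exist real 2×2 matrices A and B such that every eigenvalue of A (as a root in ℂ of its characteristic polynomial) has strictly negative real part, every eigenvalue of B has strictly negative real part, and yet A + B has an eigenvalue with strictly positive real part (the Turing instability). -/
theorem Matrix.mem_roots_charpoly_fin_two (M : Matrix (Fin 2) (Fin 2) ℂ) (μ : ℂ) :
    μ ∈ M.charpoly.roots ↔ (μ - M 0 0) * (μ - M 1 1) = M 0 1 * M 1 0 := by
  rw [Polynomial.mem_roots M.charpoly_monic.ne_zero, Polynomial.IsRoot, Matrix.eval_charpoly,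
    Matrix.det_fin_two]
  simp [sub_eq_zero]

/-- **Turing instability.** There exist real 2×2 matrices `A` and `B` such that every
eigenvalue of `A` (root in `ℂ` of its characteristic polynomial) has strictly negative
real part, every eigenvalue of `B` has strictly negative real part, and yet `A + B` has
an eigenvalue with strictly positive real part. -/
theorem turing_instability :
    ∃ A B : Matrix (Fin 2) (Fin 2) ℝ,
      (∀ μ : ℂ, μ ∈ (Matrix.charpoly (A.map (Complex.ofReal : ℝ → ℂ))).roots → μ.re < 0) ∧
      (∀ μ : ℂ, μ ∈ (Matrix.charpoly (B.map (Complex.ofReal : ℝ → ℂ))).roots → μ.re < 0) ∧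
      (∃ μ : ℂ, μ ∈ (Matrix.charpoly ((A + B).map (Complex.ofReal : ℝ → ℂ))).roots ∧
        0 < μ.re) := by
  refine ⟨!![-1, 4; 0, -1], !![-1, 0; 4, -1], fun μ hμ => ?_, fun μ hμ => ?_, 2, ?_, by norm_num⟩
  · rw [Matrix.mem_roots_charpoly_fin_two] at hμ
    have h : μ = -1 := by simpa [add_eq_zero_iff_eq_neg] using hμ
    simp [h]
  · rw [Matrix.mem_roots_charpoly_fin_two] at hμ
    have h : μ = -1 := by simpa [add_eq_zero_iff_eq_neg] using hμ
    simp [h]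
  · rw [Matrix.mem_roots_charpoly_fin_two]
    simp
    norm_num
end

section
/- There exists a constant C such that for every real ξ with |ξ| ≥ 2 there is an invertible 2×2 complex matrix P(ξ) with ‖P(ξ)‖·‖P(ξ)⁻¹‖ ≤ C such that P(ξ)⁻¹ M(ξ) P(ξ) is a diagonal matrix whose diagonal entries are purely imaginary (namely ±i√(ξ⁴ − ξ²)). That is, M(ξ) is uniformly diagonalizable with purely imaginary spectrum for |ξ| ≥ 2. -/
/-- The Fourier amplification matrix `M(ξ) = [[iξ², −iξ], [iξ, −iξ²]]` of the system
`∂ₜu + i∂ₓ²u + ∂ₓv = 0`, `∂ₜv − i∂ₓ²v − ∂ₓu = 0`. -/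
noncomputable def ampMatrix (ξ : ℝ) : Matrix (Fin 2) (Fin 2) ℂ :=
  !![Complex.I * (ξ : ℂ) ^ 2, -(Complex.I * (ξ : ℂ));
     Complex.I * (ξ : ℂ), -(Complex.I * (ξ : ℂ) ^ 2)]

/-- The operator norm on 2×2 complex matrices induced by the Euclidean norm on `ℂ²`. -/
noncomputable def euclideanOpNorm (A : Matrix (Fin 2) (Fin 2) ℂ) : ℝ :=
  ‖Matrix.toEuclideanCLM (𝕜 := ℂ) A‖

/-- The triangle inequality for `a • (1 + r • J)`, with `J` the coordinate swap. -/
lemma euclideanOpNorm_smul_symm_le (a r : ℂ) :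
    euclideanOpNorm (a • !![1, r; r, 1]) ≤
      ‖a‖ * (euclideanOpNorm 1 + ‖r‖ * euclideanOpNorm !![0, 1; 1, 0]) := by
  have h : (!![1, r; r, 1] : Matrix (Fin 2) (Fin 2) ℂ) = 1 + r • !![0, 1; 1, 0] := by
    ext i j
    fin_cases i <;> fin_cases j <;> simp
  unfold euclideanOpNorm
  rw [h, map_smul, map_add, map_smul, norm_smul, ← norm_smul r]
  gcongr
  exact norm_add_le _ _

/-- The slope `r = (ξ² - √(ξ⁴ - ξ²)) / ξ` of the eigenvectors `(1, r)` and `(r, 1)` of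
`ampMatrix ξ`. -/
lemma exists_eigenvector_slope {ξ : ℝ} (hξ : 2 ≤ |ξ|) :
    ∃ r : ℝ, |r| ≤ 1 / 2 ∧ √(ξ ^ 4 - ξ ^ 2) = ξ ^ 2 - ξ * r ∧ r ^ 2 + 1 = 2 * ξ * r := by
  have hξ0 : ξ ≠ 0 := by
    rintro rfl
    norm_num at hξ
  have h4 : 4 ≤ ξ ^ 2 := by
    rw [← sq_abs]
    nlinarith
  have hs0 := Real.sqrt_nonneg (ξ ^ 4 - ξ ^ 2)
  have hs := Real.sq_sqrt (show 0 ≤ ξ ^ 4 - ξ ^ 2 by nlinarith)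
  set s := √(ξ ^ 4 - ξ ^ 2)
  have hr : ξ * ((ξ ^ 2 - s) / ξ) = ξ ^ 2 - s := by field_simp
  set r := (ξ ^ 2 - s) / ξ
  have hs_eq : s = ξ ^ 2 - ξ * r := by linarith
  have hquad : r ^ 2 + 1 = 2 * ξ * r := by
    have : ξ ^ 2 * (r ^ 2 + 1 - 2 * ξ * r) = 0 := by
      rw [hs_eq] at hs
      linear_combination hs
    have := (mul_eq_zero.mp this).resolve_left (pow_ne_zero 2 hξ0)
    linarith
  refine ⟨r, ?_, hs_eq, hquad⟩
  have hle : |ξ| * |r| ≤ 1 := by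
    rw [← abs_mul, hr, abs_le]
    constructor <;> nlinarith
  nlinarith [abs_nonneg r]

/-- For `|ξ| ≥ 2`, the matrix `M(ξ)` is uniformly diagonalizable with purely imaginary
spectrum: there are invertible `P(ξ)` with `‖P(ξ)‖·‖P(ξ)⁻¹‖ ≤ C` uniformly, conjugating
`M(ξ)` to the diagonal matrix with entries `±i√(ξ⁴ − ξ²)` (which are purely imaginary). -/
theorem ampMatrix_uniformly_diagonalizable :
    ∃ C : ℝ, ∀ ξ : ℝ, 2 ≤ |ξ| →
      ∃ P : Matrix (Fin 2) (Fin 2) ℂ, IsUnit P.det ∧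
        euclideanOpNorm P * euclideanOpNorm P⁻¹ ≤ C ∧
        P⁻¹ * ampMatrix ξ * P =
          Matrix.diagonal
            ![Complex.I * (Real.sqrt (ξ ^ 4 - ξ ^ 2) : ℂ),
              -(Complex.I * (Real.sqrt (ξ ^ 4 - ξ ^ 2) : ℂ))] ∧
        (∀ i : Fin 2,
          ((Matrix.diagonal
            ![Complex.I * (Real.sqrt (ξ ^ 4 - ξ ^ 2) : ℂ),
              -(Complex.I * (Real.sqrt (ξ ^ 4 - ξ ^ 2) : ℂ))]) i i).re = 0) := by
  obtain ⟨K, hK⟩ : ∃ K : ℝ, K =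
      euclideanOpNorm 1 + 1 / 2 * euclideanOpNorm !![0, 1; 1, 0] := ⟨_, rfl⟩
  have norm_le (a r : ℂ) (hr : ‖r‖ ≤ 1 / 2) :
      euclideanOpNorm (a • !![1, r; r, 1]) ≤ ‖a‖ * K := by
    refine (euclideanOpNorm_smul_symm_le a r).trans ?_
    have : 0 ≤ euclideanOpNorm !![0, 1; 1, 0] := norm_nonneg _
    rw [hK]
    gcongr
  have hK0 : 0 ≤ K := by
    have := (norm_nonneg _).trans (norm_le 1 0 (by norm_num))
    simpa using this
  refine ⟨K * (4 / 3 * K), fun ξ hξ => ?_⟩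
  obtain ⟨r, hr, hs, hquad⟩ := exists_eigenvector_slope hξ
  have hr2 : r ^ 2 ≤ 1 / 4 := by
    rw [← sq_abs]
    nlinarith [abs_nonneg r]
  have hrC : ‖(r : ℂ)‖ ≤ 1 / 2 := by simpa using hr
  have hdet : (!![1, (r : ℂ); (r : ℂ), 1]).det = ((1 - r ^ 2 : ℝ) : ℂ) := by
    rw [Matrix.det_fin_two_of]
    push_cast
    ring
  have hdet0 : ((1 - r ^ 2 : ℝ) : ℂ) ≠ 0 := by
    rw [Complex.ofReal_ne_zero]
    linarith
  have hunit : IsUnit (!![1, (r : ℂ); (r : ℂ), 1]).det := by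
    rw [hdet]
    exact hdet0.isUnit
  have hinv : (!![1, (r : ℂ); (r : ℂ), 1])⁻¹ =
      ((1 - r ^ 2 : ℝ) : ℂ)⁻¹ • !![1, -(r : ℂ); -(r : ℂ), 1] := by
    rw [Matrix.inv_def, hdet, Matrix.adjugate_fin_two_of, Ring.inverse_eq_inv']
  refine ⟨!![1, (r : ℂ); (r : ℂ), 1], hunit, ?_, ?_, fun i => ?_⟩
  · have hP := norm_le 1 r hrC
    rw [one_smul, norm_one, one_mul] at hP
    have hPinv := norm_le ((1 - r ^ 2 : ℝ) : ℂ)⁻¹ (-r) (by rwa [norm_neg])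
    rw [← hinv, norm_inv, Complex.norm_real, Real.norm_of_nonneg (by linarith)] at hPinv
    have hcoef : (1 - r ^ 2)⁻¹ ≤ 4 / 3 := by
      rw [inv_le_comm₀ (by linarith) (by norm_num)]
      linarith
    exact mul_le_mul hP (hPinv.trans (by gcongr)) (norm_nonneg _) hK0
  · have hquadC : (r : ℂ) ^ 2 + 1 = 2 * ξ * r := by exact_mod_cast hquad
    rw [mul_assoc, hs]
    refine (congrArg _ ?_).trans (Matrix.nonsing_inv_mul_cancel_left _ _ hunit)
    ext i j
    fin_cases i <;> fin_cases j <;>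
      simp [ampMatrix, Matrix.mul_apply, Fin.sum_univ_two]
    · ring
    · linear_combination (-Complex.I * ξ) * hquadC
    · linear_combination (Complex.I * ξ) * hquadC
    · ring
  · fin_cases i <;> simp
end

section
/- Let A be an N×N complex Hermitian matrix with spectral decomposition A = Σ_{p=1}^m λ_p Π_p, where λ_1, …, λ_m are distinct real numbers and Π_1, …, Π_m are Hermitian matrices satisfying Π_p Π_q = 0 for p ≠ q, Π_p² = Π_p, and Σ_p Π_p = I. Let B be an N×N complex matrix whose anti-Hermitian part Im B := (B − B*)/(2i) satisfies Π_p (Im B) Π_p = 0 for every p. Then the matrix V := Σ_{p ≠ q} (i/(λ_q − λ_p)) · Π_p (Im B) Π_q is Hermitian, the commutator [V, A] = VA − AV equals i·Im B, and consequently B − [V, A] = (B + B*)/2 is Hermitian. (This is the algebraic conjugation step: adding the commutator with the dispersive symbol symmetrizes the first order symbol.) -/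
open Matrix

section SpectralCommutator

variable {n ι : Type*} [Fintype n] [Fintype ι]

/-- The solution of the commutator equation `[V, ∑ p, lam p • P p] = i • M` which is off-diagonal
with respect to the projections `P p`. -/
noncomputable def commutatorSolution [DecidableEq ι] (lam : ι → ℝ) (P : ι → Matrix n n ℂ)
    (M : Matrix n n ℂ) : Matrix n n ℂ :=
  ∑ p, ∑ q, if p = q then 0 else
    (Complex.I / ((lam q : ℂ) - (lam p : ℂ))) • (P p * M * P q)

theorem commutatorSolution_isHermitian [DecidableEq ι] (lam : ι → ℝ) {P : ι → Matrix n n ℂ}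
    {M : Matrix n n ℂ} (hP : ∀ p, (P p).IsHermitian) (hM : M.IsHermitian) :
    (commutatorSolution lam P M).IsHermitian := by
  unfold commutatorSolution Matrix.IsHermitian
  simp only [conjTranspose_sum]
  rw [Finset.sum_comm]
  refine Finset.sum_congr rfl fun p _ => Finset.sum_congr rfl fun q _ => ?_
  by_cases h : p = q
  · simp [h]
  · rw [if_neg h, if_neg (Ne.symm h), conjTranspose_smul, conjTranspose_mul, conjTranspose_mul,
      (hP p).eq, (hP q).eq, hM.eq, ← Matrix.mul_assoc]
    congr 1
    simp only [star_div₀, star_sub, Complex.star_def, Complex.conj_I, Complex.conj_ofReal]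
    rw [← neg_sub (lam q : ℂ), neg_div_neg_eq]

theorem proj_mul_sum_smul (lam : ι → ℝ) {P : ι → Matrix n n ℂ}
    (hOrth : ∀ p q, p ≠ q → P p * P q = 0) (hIdem : ∀ p, P p * P p = P p) (q : ι) :
    P q * ∑ p, (lam p : ℂ) • P p = (lam q : ℂ) • P q := by
  rw [Finset.mul_sum, Finset.sum_eq_single q]
  · rw [Matrix.mul_smul, hIdem]
  · intro p _ h
    rw [Matrix.mul_smul, hOrth q p h.symm, smul_zero]
  · simp

theorem sum_smul_mul_proj (lam : ι → ℝ) {P : ι → Matrix n n ℂ}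
    (hOrth : ∀ p q, p ≠ q → P p * P q = 0) (hIdem : ∀ p, P p * P p = P p) (q : ι) :
    (∑ p, (lam p : ℂ) • P p) * P q = (lam q : ℂ) • P q := by
  rw [Finset.sum_mul, Finset.sum_eq_single q]
  · rw [Matrix.smul_mul, hIdem]
  · intro p _ h
    rw [Matrix.smul_mul, hOrth p q h, smul_zero]
  · simp

theorem commutatorSolution_commutator [DecidableEq ι] [DecidableEq n] {lam : ι → ℝ}
    (hlam : Function.Injective lam) {P : ι → Matrix n n ℂ} {M : Matrix n n ℂ}
    (hOrth : ∀ p q, p ≠ q → P p * P q = 0) (hIdem : ∀ p, P p * P p = P p)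
    (hSum : ∑ p, P p = 1) (hM : ∀ p, P p * M * P p = 0) :
    commutatorSolution lam P M * (∑ p, (lam p : ℂ) • P p) -
      (∑ p, (lam p : ℂ) • P p) * commutatorSolution lam P M = Complex.I • M := by
  have hdecomp : M = ∑ p, ∑ q, P p * M * P q := by
    simp only [← Finset.mul_sum, ← Finset.sum_mul, hSum, Matrix.one_mul, Matrix.mul_one]
  have hright := proj_mul_sum_smul lam hOrth hIdem
  have hleft := sum_smul_mul_proj lam hOrth hIdem
  conv_rhs => rw [hdecomp]
  generalize (∑ p, (lam p : ℂ) • P p) = A at hright hleft ⊢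
  unfold commutatorSolution
  simp only [Finset.sum_mul, Finset.mul_sum, ← Finset.sum_sub_distrib, Finset.smul_sum]
  refine Finset.sum_congr rfl fun p _ => Finset.sum_congr rfl fun q _ => ?_
  by_cases h : p = q
  · subst h
    simp [hM]
  · have hne : (lam q : ℂ) - (lam p : ℂ) ≠ 0 :=
      sub_ne_zero.mpr fun e => h (hlam (Complex.ofReal_injective e)).symm
    rw [if_neg h, Matrix.smul_mul, Matrix.mul_smul, Matrix.mul_assoc _ (P q) A, hright,
      ← Matrix.mul_assoc A, ← Matrix.mul_assoc A, hleft, Matrix.mul_smul, Matrix.smul_mul,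
      Matrix.smul_mul, ← smul_sub, ← sub_smul, smul_smul, div_mul_cancel₀ _ hne]

end SpectralCommutator

theorem antiHermitianPart_isHermitian {n : Type*} (B : Matrix n n ℂ) :
    ((2 * Complex.I)⁻¹ • (B - Bᴴ)).IsHermitian := by
  unfold Matrix.IsHermitian
  rw [conjTranspose_smul, conjTranspose_sub, conjTranspose_conjTranspose, ← neg_sub B, smul_neg,
    ← neg_smul]
  congr 1
  simp

/-- **Algebraic conjugation step.** Let `A = Σ λ_p Π_p` be the spectral decomposition of
a Hermitian matrix (distinct real `λ_p`, Hermitian projections `Π_p` with pairwise zero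
products summing to the identity), and let `B` be a matrix whose anti-Hermitian part
`Im B = (B − B*)/(2i)` satisfies `Π_p (Im B) Π_p = 0` for every `p`.  Then
`V := Σ_{p ≠ q} (i/(λ_q − λ_p)) Π_p (Im B) Π_q` is Hermitian, `[V, A] = i·Im B`, and
`B − [V, A] = (B + B*)/2` is Hermitian: the commutator with the dispersive symbol
symmetrizes the first order symbol. -/
theorem conjugation_symmetrizes
    (N m : ℕ)
    (A : Matrix (Fin N) (Fin N) ℂ) (hA : A.IsHermitian)
    (lam : Fin m → ℝ) (hlam : Function.Injective lam)
    (Pi : Fin m → Matrix (Fin N) (Fin N) ℂ)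
    (hPiHerm : ∀ p, (Pi p).IsHermitian)
    (hPiOrth : ∀ p q, p ≠ q → Pi p * Pi q = 0)
    (hPiIdem : ∀ p, Pi p * Pi p = Pi p)
    (hPiSum : ∑ p, Pi p = 1)
    (hSpec : A = ∑ p, (lam p : ℂ) • Pi p)
    (B : Matrix (Fin N) (Fin N) ℂ)
    (hB : ∀ p, Pi p * ((2 * Complex.I)⁻¹ • (B - Bᴴ)) * Pi p = 0) :
    (∑ p, ∑ q,
        if p = q then 0 else
          (Complex.I / ((lam q : ℂ) - (lam p : ℂ))) •
            (Pi p * ((2 * Complex.I)⁻¹ • (B - Bᴴ)) * Pi q)).IsHermitian ∧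
    ((∑ p, ∑ q,
        if p = q then 0 else
          (Complex.I / ((lam q : ℂ) - (lam p : ℂ))) •
            (Pi p * ((2 * Complex.I)⁻¹ • (B - Bᴴ)) * Pi q)) * A -
       A * (∑ p, ∑ q,
        if p = q then 0 else
          (Complex.I / ((lam q : ℂ) - (lam p : ℂ))) •
            (Pi p * ((2 * Complex.I)⁻¹ • (B - Bᴴ)) * Pi q)) =
      Complex.I • ((2 * Complex.I)⁻¹ • (B - Bᴴ))) ∧
    (B -
       ((∑ p, ∑ q,
          if p = q then 0 else
            (Complex.I / ((lam q : ℂ) - (lam p : ℂ))) •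
              (Pi p * ((2 * Complex.I)⁻¹ • (B - Bᴴ)) * Pi q)) * A -
         A * (∑ p, ∑ q,
          if p = q then 0 else
            (Complex.I / ((lam q : ℂ) - (lam p : ℂ))) •
              (Pi p * ((2 * Complex.I)⁻¹ • (B - Bᴴ)) * Pi q))) =
      (2 : ℂ)⁻¹ • (B + Bᴴ)) ∧
    ((2 : ℂ)⁻¹ • (B + Bᴴ) : Matrix (Fin N) (Fin N) ℂ).IsHermitian := by
  have hcomm := commutatorSolution_commutator hlam hPiOrth hPiIdem hPiSum hB
  rw [← hSpec] at hcomm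
  refine ⟨commutatorSolution_isHermitian lam hPiHerm (antiHermitianPart_isHermitian B), hcomm,
    (congrArg (B - ·) hcomm).trans ?_, ?_⟩
  · have hI : Complex.I * (2 * Complex.I)⁻¹ = 2⁻¹ := by
      field_simp [Complex.I_ne_zero]
    simp only [smul_smul, hI]
    module
  · unfold Matrix.IsHermitian
    rw [conjTranspose_smul, conjTranspose_add, conjTranspose_conjTranspose, add_comm]
    simp
end
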